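/- arXiv:2409.16279 — 3 statements merged into one kernel-verified Lean document; each statement's English description precedes it below -/
import Mathlib

section
/- Let G be a finite connected graph with a fixed 1-planar drawing having no ×-crossings, and let P be a shortest path of G. Then a set U of five cops has a strategy so that, after finitely many initial rounds, the subgraph P× of G× is guarded for the rest of the game; moreover a single designated cop U* of U guards all G-vertices of P×. -/
/-!
Common definitions: the game of Cops and Robbers (strategies, plays, capture,
cop number), 1-planar drawings in the plane, crossings, ×-crossings, kite
edges, guarding of vertices and crossing points, subgraphs of the
planarization, cop territory, robber territory, and the edge sets `S_H(v)`.
-/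

namespace CopsRobbersOnePlanar

/-- `f` parametrizes a simple (injective) arc from `p` to `q` over `[0,1]`. -/
structure IsArc (f : ℝ → ℝ × ℝ) (p q : ℝ × ℝ) : Prop where
  continuousOn : ContinuousOn f (Set.Icc 0 1)
  injOn : Set.InjOn f (Set.Icc 0 1)
  source : f 0 = p
  target : f 1 = q

/-- A 1-planar drawing of a simple graph `G` in the plane: vertices are mapped to
distinct points, each edge to a simple arc joining its endpoints whose interior
avoids all vertices; arcs of distinct edges meet only at shared endpoints or at
interior points; each edge has at most one interior intersection point with the
other arcs (each edge is crossed at most once); arcs of edges sharing an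
endpoint do not cross; and no three arcs pass through a common interior point. -/
structure OnePlanarDrawing {V : Type} (G : SimpleGraph V) where
  vpos : V → ℝ × ℝ
  vpos_inj : Function.Injective vpos
  arc : Sym2 V → ℝ → ℝ × ℝ
  arc_spec : ∀ u v : V, G.Adj u v →
    IsArc (arc s(u, v)) (vpos u) (vpos v) ∨ IsArc (arc s(u, v)) (vpos v) (vpos u)
  arc_avoids_vertices : ∀ e ∈ G.edgeSet, ∀ w : V,
    vpos w ∉ arc e '' Set.Ioo (0 : ℝ) 1
  arcs_meet_properly : ∀ e ∈ G.edgeSet, ∀ f ∈ G.edgeSet, e ≠ f →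
    ∀ p ∈ (arc e '' Set.Icc (0 : ℝ) 1) ∩ (arc f '' Set.Icc (0 : ℝ) 1),
      (∃ w : V, w ∈ e ∧ w ∈ f ∧ p = vpos w) ∨
        p ∈ (arc e '' Set.Ioo (0 : ℝ) 1) ∩ (arc f '' Set.Ioo (0 : ℝ) 1)
  crossed_at_most_once : ∀ e ∈ G.edgeSet,
    Set.Subsingleton {p : ℝ × ℝ | ∃ f ∈ G.edgeSet, f ≠ e ∧
      p ∈ (arc e '' Set.Ioo (0 : ℝ) 1) ∩ (arc f '' Set.Ioo (0 : ℝ) 1)}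
  no_adjacent_crossing : ∀ e ∈ G.edgeSet, ∀ f ∈ G.edgeSet, e ≠ f →
    (∃ w : V, w ∈ e ∧ w ∈ f) →
    (arc e '' Set.Ioo (0 : ℝ) 1) ∩ (arc f '' Set.Ioo (0 : ℝ) 1) = ∅
  no_triple_point : ∀ e ∈ G.edgeSet, ∀ f ∈ G.edgeSet, ∀ g ∈ G.edgeSet,
    e ≠ f → e ≠ g → f ≠ g →
    (arc e '' Set.Ioo (0 : ℝ) 1) ∩ (arc f '' Set.Ioo (0 : ℝ) 1) ∩
      (arc g '' Set.Ioo (0 : ℝ) 1) = ∅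

variable {V : Type}

/-- Two edges cross in the drawing `D`: their arcs share an interior point. -/
def OnePlanarDrawing.Crosses {G : SimpleGraph V} (D : OnePlanarDrawing G)
    (e f : Sym2 V) : Prop :=
  e ∈ G.edgeSet ∧ f ∈ G.edgeSet ∧ e ≠ f ∧
    ((D.arc e '' Set.Ioo (0 : ℝ) 1) ∩ (D.arc f '' Set.Ioo (0 : ℝ) 1)).Nonempty

/-- An edge is uncrossed in the drawing `D`. -/
def OnePlanarDrawing.Uncrossed {G : SimpleGraph V} (D : OnePlanarDrawing G)
    (e : Sym2 V) : Prop :=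
  ∀ f, ¬ D.Crosses e f

/-- An ×-crossing: a crossing such that `G` contains no edge joining any two
consecutive endpoints (i.e. endpoints of the two different crossing edges). -/
def OnePlanarDrawing.IsXCrossing {G : SimpleGraph V} (D : OnePlanarDrawing G)
    (e f : Sym2 V) : Prop :=
  D.Crosses e f ∧ ∀ u w : V, u ∈ e → w ∈ f → ¬ G.Adj u w

/-- The drawing has a kite edge at every crossing: an uncrossed edge of `G`
joining two consecutive endpoints of the crossing. -/
def OnePlanarDrawing.HasKites {G : SimpleGraph V} (D : OnePlanarDrawing G) : Prop :=
  ∀ e f, D.Crosses e f →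
    ∃ u w : V, u ∈ e ∧ w ∈ f ∧ G.Adj u w ∧ D.Uncrossed s(u, w)

/-- A strategy for `k` cops on `G`: an initial placement, and a move function
(depending on the current cop positions and the robber's position) under which
every cop either stays put or moves to an adjacent vertex. -/
structure CopStrategy (G : SimpleGraph V) (k : ℕ) where
  init : Fin k → V
  move : (Fin k → V) → V → Fin k → V
  move_valid : ∀ c r i, move c r i = c i ∨ G.Adj (c i) (move c r i)

/-- A play of the game with `k` cops on `G`: `cop n` is the cop configuration
after the cops' turn of round `n`, and `rob n` is the robber's vertex after the
robber's turn of round `n` (round `0` being the initial placements, cops first).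
In each turn every player either stays or moves to an adjacent vertex. -/
structure GamePlay (G : SimpleGraph V) (k : ℕ) where
  cop : ℕ → Fin k → V
  rob : ℕ → V
  cop_valid : ∀ n i, cop (n + 1) i = cop n i ∨ G.Adj (cop n i) (cop (n + 1) i)
  rob_valid : ∀ n, rob (n + 1) = rob n ∨ G.Adj (rob n) (rob (n + 1))

/-- The cops in the play `π` follow the strategy `cs`. -/
def GamePlay.Follows {G : SimpleGraph V} {k : ℕ} (π : GamePlay G k)
    (cs : CopStrategy G k) : Prop :=
  π.cop 0 = cs.init ∧ ∀ n, π.cop (n + 1) = cs.move (π.cop n) (π.rob n)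

/-- The robber is captured at round `n`: some cop occupies the robber's vertex,
either when the robber lands on it, or when the cops move in the next round. -/
def GamePlay.CapturedAt {G : SimpleGraph V} {k : ℕ} (π : GamePlay G k) (n : ℕ) : Prop :=
  ∃ i, π.cop n i = π.rob n ∨ π.cop (n + 1) i = π.rob n

/-- `k` cops have a winning strategy on `G`. -/
def CopsWin (G : SimpleGraph V) (k : ℕ) : Prop :=
  ∃ cs : CopStrategy G k, ∀ π : GamePlay G k, π.Follows cs → ∃ n, π.CapturedAt n

/-- The cop number of `G`: the least number of cops that can win on `G`. -/
noncomputable def copNumber (G : SimpleGraph V) : ℕ :=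
  sInf {k | CopsWin G k}

/-- From time `N` on, the designated cop `i0` guards the vertex `v` in the play
`π`: whenever the robber is on `v`, either he was already captured earlier, or
cop `i0` occupies `v` now or at the next cops' turn (immediate capture). -/
def GamePlay.GuardsVertexBy {G : SimpleGraph V} {k : ℕ} (π : GamePlay G k)
    (i0 : Fin k) (N : ℕ) (v : V) : Prop :=
  ∀ n, N ≤ n → π.rob n = v →
    (∃ m < n, π.CapturedAt m) ∨ π.cop n i0 = v ∨ π.cop (n + 1) i0 = v

/-- From time `N` on, the cops guard the vertex `v` in the play `π`: the robber
cannot land on `v` (he is captured before) or is captured immediately after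
landing on `v`. -/
def GamePlay.GuardsVertex {G : SimpleGraph V} {k : ℕ} (π : GamePlay G k)
    (N : ℕ) (v : V) : Prop :=
  ∀ n, N ≤ n → π.rob n = v →
    (∃ m < n, π.CapturedAt m) ∨ ∃ i, π.cop n i = v ∨ π.cop (n + 1) i = v

/-- From time `N` on, the cops prevent the robber from traversing the edge `e`
(from one endpoint to the opposite endpoint): the robber was captured before
completing such a move, or is captured immediately after making it.  Guarding a
crossing point means preventing traversal of both edges of the crossing. -/
def GamePlay.GuardsTraversal {G : SimpleGraph V} {k : ℕ} (π : GamePlay G k)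
    (N : ℕ) (e : Sym2 V) : Prop :=
  ∀ n, N ≤ n → ∀ u w : V, e = s(u, w) → π.rob n = u → π.rob (n + 1) = w →
    (∃ m < n + 1, π.CapturedAt m) ∨
      ∃ i, π.cop (n + 1) i = w ∨ π.cop (n + 2) i = w

/-- As `GamePlay.GuardsTraversal`, but the capturing cop right after the
traversal is required to come from the index set `I`. -/
def GamePlay.GuardsTraversalOn {G : SimpleGraph V} {k : ℕ} (π : GamePlay G k)
    (I : Set (Fin k)) (N : ℕ) (e : Sym2 V) : Prop :=
  ∀ n, N ≤ n → ∀ u w : V, e = s(u, w) → π.rob n = u → π.rob (n + 1) = w →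
    (∃ m < n + 1, π.CapturedAt m) ∨
      ∃ i ∈ I, π.cop (n + 1) i = w ∨ π.cop (n + 2) i = w

/-- A subgraph `H` of the planarization `G×`, recorded by its vertex set:
`gverts` is its set of `G`-vertices, and `dummies` is the set of crossed edges
of `G` whose crossing point (dummy vertex) belongs to `H`; the latter is closed
under crossing partners since both edges of a crossing carry the same dummy
vertex. -/
structure PlanSubgraph (G : SimpleGraph V) (D : OnePlanarDrawing G) where
  gverts : Set V
  dummies : Set (Sym2 V)
  dummies_crossed : ∀ e ∈ dummies, ∃ f, D.Crosses e f
  dummies_closed : ∀ e ∈ dummies, ∀ f, D.Crosses e f → f ∈ dummies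

/-- The subgraph `H` of `G×` is guarded from time `N` on in the play `π`: all
its `G`-vertices are guarded and all its dummy vertices (crossing points) are
guarded. -/
def GuardedSubgraph {G : SimpleGraph V} {D : OnePlanarDrawing G} {k : ℕ}
    (π : GamePlay G k) (N : ℕ) (H : PlanSubgraph G D) : Prop :=
  (∀ v ∈ H.gverts, π.GuardsVertex N v) ∧
    (∀ e ∈ H.dummies, π.GuardsTraversal N e)

/-- The edge set of the cop territory `C(H)`: edges `e` of `G` with
`e× ∩ H ≠ ∅`, i.e. an endpoint of `e` is a `G`-vertex of `H`, or the crossing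
point of `e` is a dummy vertex of `H`. -/
def copTerritoryEdges {G : SimpleGraph V} {D : OnePlanarDrawing G}
    (H : PlanSubgraph G D) : Set (Sym2 V) :=
  {e | e ∈ G.edgeSet ∧ ((∃ v ∈ e, v ∈ H.gverts) ∨ e ∈ H.dummies)}

/-- The vertex set of the robber territory `R(H)`: the connected component of
`G` minus the edges of the cop territory that contains the robber's current
vertex `r`. -/
def robberTerritory {G : SimpleGraph V} {D : OnePlanarDrawing G}
    (H : PlanSubgraph G D) (r : V) : Set V :=
  {w | (G.deleteEdges (copTerritoryEdges H)).Reachable r w}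

/-- The edge set of the robber territory `R(H)`. -/
def robberTerritoryEdges {G : SimpleGraph V} {D : OnePlanarDrawing G}
    (H : PlanSubgraph G D) (r : V) : Set (Sym2 V) :=
  {e | e ∈ (G.deleteEdges (copTerritoryEdges H)).edgeSet ∧
    ∀ v ∈ e, v ∈ robberTerritory H r}

/-- `S_H(v)` for a `G`-vertex `v` of `H` (with the robber at `r`): the edges
`e` of `G` joining `v` to a vertex of the robber territory `R(H)` such that
`e× ∩ H = {v}`. -/
def SH {G : SimpleGraph V} {D : OnePlanarDrawing G}
    (H : PlanSubgraph G D) (r v : V) : Set (Sym2 V) :=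
  {e | ∃ w : V, e = s(v, w) ∧ G.Adj v w ∧ w ∈ robberTerritory H r ∧
    w ∉ H.gverts ∧ e ∉ H.dummies}

end CopsRobbersOnePlanar

namespace CopsRobbersOnePlanar

/-- Every vertex of a shortest walk is at distance equal to its index from the start. -/
lemma dist_getVert_of_length_eq_dist {V : Type} {G : SimpleGraph V} (hconn : G.Connected)
    {x y : V} (P : G.Walk x y) (hshort : P.length = G.dist x y) {k : ℕ} (hk : k ≤ P.length) :
    G.dist x (P.getVert k) = k := by
  have h1 : G.dist x (P.getVert k) ≤ k :=
    (SimpleGraph.dist_le (P.take k)).trans (by simp [SimpleGraph.Walk.take_length])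
  have h2 : G.dist (P.getVert k) y ≤ P.length - k :=
    (SimpleGraph.dist_le (P.drop k)).trans (by simp [SimpleGraph.Walk.drop_length])
  have h3 := hconn.dist_triangle (u := x) (v := P.getVert k) (w := y)
  omega

/-- Distances to a fixed vertex change by at most one when moving to a closed neighbour. -/
lemma dist_le_succ_of_eq_or_adj {V : Type} {G : SimpleGraph V} (hconn : G.Connected)
    (x : V) {u v : V} (h : v = u ∨ G.Adj u v) :
    G.dist x v ≤ G.dist x u + 1 ∧ G.dist x u ≤ G.dist x v + 1 := by
  rcases h with rfl | h
  · omega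
  · have h1 := hconn.dist_triangle (u := x) (v := u) (w := v)
    have h2 := hconn.dist_triangle (u := x) (v := v) (w := u)
    rw [SimpleGraph.dist_eq_one_iff_adj.2 h] at h1
    rw [SimpleGraph.dist_eq_one_iff_adj.2 h.symm] at h2
    exact ⟨h1, h2⟩

/-- The index on `P` that cop `i` aims for when the robber is at `r`: the distance from `x`
to `r`, shifted by one of the offsets `0, 1, 2, -2, -1` and clamped to the range of `P`. -/
noncomputable def shadowIndex {V : Type} {G : SimpleGraph V} {x y : V} (P : G.Walk x y)
    (i : Fin 5) (r : V) : ℕ :=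
  min P.length (G.dist x r + (i.val + 2) % 5 - 2)

/-- One step on the integers from `k` towards `t`. -/
def stepTowards (k t : ℕ) : ℕ :=
  if k < t then k + 1 else if t < k then k - 1 else k

/-- The position cop `i` wants to move to from `c` when the robber is at `r`. -/
noncomputable def shadowMove {V : Type} {G : SimpleGraph V} {x y : V} (P : G.Walk x y)
    (i : Fin 5) (c r : V) : V :=
  P.getVert (stepTowards (G.dist x c) (shadowIndex P i r))

open Classical in
/-- All cops start at `x`; a cop captures the robber if possible, and otherwise
moves along `P` towards its shifted shadow of the robber. -/
noncomputable def shadowStrategy {V : Type} (G : SimpleGraph V) {x y : V} (P : G.Walk x y) :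
    CopStrategy G 5 where
  init := fun _ => x
  move := fun c r i =>
    if r = c i ∨ G.Adj (c i) r then r
    else if G.Adj (c i) (shadowMove P i (c i) r) then shadowMove P i (c i) r
    else c i
  move_valid := by
    intro c r i
    split_ifs with h1 h2
    · exact h1
    · exact Or.inr h2
    · exact Or.inl rfl

section Strategy

variable {V : Type} {G : SimpleGraph V} {x y : V} {P : G.Walk x y} {π : GamePlay G 5}

lemma cop_succ_eq_rob (hπ : π.Follows (shadowStrategy G P)) {n : ℕ} {i : Fin 5}
    (h : π.rob n = π.cop n i ∨ G.Adj (π.cop n i) (π.rob n)) :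
    π.cop (n + 1) i = π.rob n := by
  rw [hπ.2 n]
  simp only [shadowStrategy]
  rw [if_pos h]

/-- As long as the robber is not captured, a cop at index `k` of `P` moves one step
along `P` towards its target index. -/
lemma cop_succ_eq_getVert (hconn : G.Connected) (hshort : P.length = G.dist x y)
    (hπ : π.Follows (shadowStrategy G P)) {n : ℕ} {i : Fin 5}
    (hcap : ¬ π.CapturedAt n) {k : ℕ} (hk : k ≤ P.length) (hc : π.cop n i = P.getVert k) :
    π.cop (n + 1) i = P.getVert (stepTowards k (shadowIndex P i (π.rob n))) := by
  have hfar : ¬ (π.rob n = π.cop n i ∨ G.Adj (π.cop n i) (π.rob n)) :=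
    fun h => hcap ⟨i, Or.inr (cop_succ_eq_rob hπ h)⟩
  have hd := dist_getVert_of_length_eq_dist hconn P hshort hk
  have ht : shadowIndex P i (π.rob n) ≤ P.length := min_le_left _ _
  have hmove : shadowMove P i (π.cop n i) (π.rob n) =
      P.getVert (stepTowards k (shadowIndex P i (π.rob n))) := by
    rw [shadowMove, hc, hd]
  rw [hπ.2 n]
  simp only [shadowStrategy]
  rw [if_neg hfar, hmove, hc]
  split_ifs with hadj
  · rfl
  · unfold stepTowards at hadj ⊢
    split_ifs at hadj ⊢ with h1 h2
    · exact absurd (P.adj_getVert_succ (by omega)) hadj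
    · obtain ⟨j, rfl⟩ : ∃ j, k = j + 1 := ⟨k - 1, by omega⟩
      exact absurd (P.adj_getVert_succ (by omega)).symm hadj
    · rfl

lemma shadowIndex_succ_le (hconn : G.Connected) (P : G.Walk x y) (i : Fin 5) (n : ℕ) :
    shadowIndex P i (π.rob (n + 1)) ≤ shadowIndex P i (π.rob n) + 1 ∧
      shadowIndex P i (π.rob n) ≤ shadowIndex P i (π.rob (n + 1)) + 1 := by
  have h := dist_le_succ_of_eq_or_adj hconn x (π.rob_valid n)
  unfold shadowIndex
  omega

/-- As long as the robber is not captured, each cop either is at its target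
or is still walking along `P` from its start towards the target. -/
lemma cop_succ_at_or_behind_shadow (hconn : G.Connected) (hshort : P.length = G.dist x y)
    (hπ : π.Follows (shadowStrategy G P)) (i : Fin 5) (n : ℕ)
    (hcap : ∀ m < n + 1, ¬ π.CapturedAt m) :
    ∃ k ≤ P.length, π.cop (n + 1) i = P.getVert k ∧
      (k = shadowIndex P i (π.rob n) ∨ k = n + 1 ∧ k < shadowIndex P i (π.rob n)) := by
  have ht (m : ℕ) : shadowIndex P i (π.rob m) ≤ P.length := min_le_left _ _
  induction n with
  | zero =>
    have h0 : π.cop 0 i = P.getVert 0 := by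
      rw [hπ.1]
      simp [shadowStrategy]
    refine ⟨_, ?_, cop_succ_eq_getVert hconn hshort hπ (hcap 0 (by omega)) (Nat.zero_le _) h0, ?_⟩
    all_goals
      have := ht 0
      unfold stepTowards
      split_ifs <;> omega
  | succ n ih =>
    obtain ⟨k, hk, hc, hk'⟩ := ih fun m hm => hcap m (by omega)
    refine ⟨_, ?_, cop_succ_eq_getVert hconn hshort hπ (hcap (n + 1) (by omega)) hk hc, ?_⟩
    all_goals
      have := ht (n + 1)
      have := shadowIndex_succ_le (π := π) hconn P i n
      unfold stepTowards
      split_ifs <;> omega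

/-- After `P.length` rounds, an uncaptured robber is shadowed by all cops. -/
lemma cop_succ_eq_shadow (hconn : G.Connected) (hshort : P.length = G.dist x y)
    (hπ : π.Follows (shadowStrategy G P)) (i : Fin 5) {n : ℕ} (hn : P.length ≤ n)
    (hcap : ∀ m < n + 1, ¬ π.CapturedAt m) :
    π.cop (n + 1) i = P.getVert (shadowIndex P i (π.rob n)) := by
  obtain ⟨k, hk, hc, hk'⟩ := cop_succ_at_or_behind_shadow hconn hshort hπ i n hcap
  have hkt : k = shadowIndex P i (π.rob n) := by omega
  rw [hc, hkt]

/-- Cop `0` guards every vertex of `P`. -/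
lemma guardsVertexBy_of_mem_support (hconn : G.Connected) (hshort : P.length = G.dist x y)
    (hπ : π.Follows (shadowStrategy G P)) {v : V} (hv : v ∈ P.support) :
    π.GuardsVertexBy 0 (P.length + 1) v := by
  intro n hn hr
  by_cases hcap : ∃ m < n, π.CapturedAt m
  · exact Or.inl hcap
  push Not at hcap
  right; right
  obtain ⟨n, rfl⟩ : ∃ m, n = m + 1 := ⟨n - 1, by omega⟩
  obtain ⟨j, rfl, hj⟩ := SimpleGraph.Walk.mem_support_iff_exists_getVert.1 hv
  have hc := cop_succ_eq_shadow hconn hshort hπ 0 (by omega) hcap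
  have hd := dist_getVert_of_length_eq_dist hconn P hshort hj
  have hlip := dist_le_succ_of_eq_or_adj hconn x (π.rob_valid n)
  rw [hr, hd] at hlip
  rw [← hr]
  apply cop_succ_eq_rob hπ
  rw [hc, hr]
  have hs : shadowIndex P 0 (π.rob n) = min P.length (G.dist x (π.rob n)) := by
    simp [shadowIndex]
  obtain h | h | h : shadowIndex P 0 (π.rob n) = j ∨ shadowIndex P 0 (π.rob n) + 1 = j ∨
      shadowIndex P 0 (π.rob n) = j + 1 := by omega
  · exact Or.inl (by rw [h])
  · right
    rw [← h]
    exact P.adj_getVert_succ (by omega)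
  · right
    rw [h]
    exact (P.adj_getVert_succ (by omega)).symm

/-- The cops guard every neighbour of a vertex of `P`. -/
lemma guardsVertex_of_adj_mem_support (hconn : G.Connected) (hshort : P.length = G.dist x y)
    (hπ : π.Follows (shadowStrategy G P)) {u v : V} (hu : u ∈ P.support) (huv : G.Adj u v) :
    π.GuardsVertex (P.length + 1) v := by
  intro n hn hr
  by_cases hcap : ∃ m < n, π.CapturedAt m
  · exact Or.inl hcap
  push Not at hcap
  right
  obtain ⟨n, rfl⟩ : ∃ m, n = m + 1 := ⟨n - 1, by omega⟩
  obtain ⟨j, rfl, hj⟩ := SimpleGraph.Walk.mem_support_iff_exists_getVert.1 hu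
  have hd := dist_getVert_of_length_eq_dist hconn P hshort hj
  have hadj := dist_le_succ_of_eq_or_adj hconn x (Or.inr huv)
  have hlip := dist_le_succ_of_eq_or_adj hconn x (π.rob_valid n)
  rw [hr] at hlip
  rw [hd] at hadj
  let i : Fin 5 := ⟨(j + 5 - G.dist x (π.rob n)) % 5, Nat.mod_lt _ (by norm_num)⟩
  have hi : shadowIndex P i (π.rob n) = j := by
    simp only [shadowIndex, i]
    omega
  have hc := cop_succ_eq_shadow hconn hshort hπ i (by omega) hcap
  rw [hi] at hc
  refine ⟨i, Or.inr ?_⟩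
  rw [← hr]
  apply cop_succ_eq_rob hπ
  rw [hc, hr]
  exact Or.inr huv

end Strategy

/-- If one endpoint of an edge is guarded, then so is its traversal in both directions. -/
lemma GamePlay.GuardsVertex.guardsTraversal {V : Type} {G : SimpleGraph V} {k : ℕ}
    {π : GamePlay G k} {N : ℕ} {v : V} {e : Sym2 V} (h : π.GuardsVertex N v) (hv : v ∈ e) :
    π.GuardsTraversal N e := by
  rintro n hn u w rfl hu hw
  rcases Sym2.mem_iff.1 hv with rfl | rfl
  · left
    rcases h n hn hu with ⟨m, hm, hc⟩ | ⟨i, hi⟩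
    · exact ⟨m, by omega, hc⟩
    · exact ⟨n, by omega, i, by rwa [hu]⟩
  · exact h (n + 1) (by omega) hw

/-- Corollary 1. Let `G` be a finite connected graph with a
fixed 1-planar drawing without ×-crossings, and let `P` be a shortest path of
`G`.  Then five cops have a strategy such that, after finitely many initial
rounds, `P×` is guarded for the rest of the game (all vertices of `P` and all
crossing points on edges of `P`), and the designated cop `U* = 0` guards all
`G`-vertices of `P×`. -/
theorem five_cops_guard_shortest_path_no_xcrossings
    {V : Type} [Fintype V] (G : SimpleGraph V) (hconn : G.Connected)
    (D : OnePlanarDrawing G)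
    (hnoX : ∀ e f : Sym2 V, ¬ D.IsXCrossing e f)
    {x y : V} (P : G.Walk x y) (hpath : P.IsPath)
    (hshort : P.length = G.dist x y) :
    ∃ cs : CopStrategy G 5, ∀ π : GamePlay G 5, π.Follows cs →
      ∃ N : ℕ,
        (∀ v ∈ P.support, π.GuardsVertexBy 0 N v) ∧
        (∀ e ∈ P.edges, ∀ f : Sym2 V, D.Crosses e f →
          π.GuardsTraversal N e ∧ π.GuardsTraversal N f) := by
  refine ⟨shadowStrategy G P, fun π hπ => ⟨P.length + 1,
    fun v hv => guardsVertexBy_of_mem_support hconn hshort hπ hv, fun e he f hef => ?_⟩⟩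
  have hsupp : ∀ u ∈ e, u ∈ P.support := fun u hu =>
    P.mem_support_of_mem_edges he hu
  constructor
  · obtain ⟨u, hu⟩ : ∃ u, u ∈ e := ⟨_, e.out_fst_mem⟩
    have hg : π.GuardsVertex (P.length + 1) u := fun n hn hr =>
      (guardsVertexBy_of_mem_support hconn hshort hπ (hsupp u hu) n hn hr).imp_right
        fun h => ⟨0, h⟩
    exact hg.guardsTraversal hu
  · have hnot := hnoX e f
    simp only [OnePlanarDrawing.IsXCrossing, not_and, not_forall, not_not] at hnot
    obtain ⟨u, w, hu, hw, huw⟩ := hnot hef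
    exact (guardsVertex_of_adj_mem_support hconn hshort hπ (hsupp u hu) huw).guardsTraversal hw

end CopsRobbersOnePlanar
end

section
/- Let G be a finite connected graph with a fixed 1-planar drawing having no ×-crossings and with a kite edge at every crossing, and let H be a guarded subgraph of G×. Then the robber territory R(H), with its drawing inherited from G, is a 1-plane graph without ×-crossings; i.e., R(H) ∈ Ĝ. -/
namespace CopsRobbersOnePlanar

/-- Observation 2. Let `G` be a finite connected graph with a
fixed 1-planar drawing having no ×-crossings and a kite edge at every crossing,
and let `H` be a subgraph of `G×` guarded (from time `N` on) in a play `π`.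
Then the robber territory `R(H)` (taken at the robber's current vertex
`π.rob n`, `n ≥ N`), with its drawing inherited from `G`, is a 1-plane graph
without ×-crossings: every crossing between two edges of `R(H)` has an edge of
`R(H)` joining two consecutive endpoints. -/
theorem robberTerritory_no_xcrossings
    {V : Type} [Fintype V] (G : SimpleGraph V) (hconn : G.Connected)
    (D : OnePlanarDrawing G)
    (hnoX : ∀ e f : Sym2 V, ¬ D.IsXCrossing e f) (hkite : D.HasKites)
    {k : ℕ} (π : GamePlay G k) (N : ℕ) (H : PlanSubgraph G D)
    (hguard : GuardedSubgraph π N H) (n : ℕ) (hn : N ≤ n) :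
    ∀ e f : Sym2 V, D.Crosses e f →
      e ∈ robberTerritoryEdges H (π.rob n) →
      f ∈ robberTerritoryEdges H (π.rob n) →
      ∃ u w : V, u ∈ e ∧ w ∈ f ∧ s(u, w) ∈ robberTerritoryEdges H (π.rob n) := by
  rintro e f hef ⟨he, heR⟩ ⟨hf, hfR⟩
  rw [SimpleGraph.edgeSet_deleteEdges] at he hf
  obtain ⟨u, w, hu, hw, hadj, hun⟩ := hkite e f hef
  have hu_not_mem : u ∉ H.gverts := fun h => he.2 ⟨he.1, Or.inl ⟨u, hu, h⟩⟩
  have hw_not_mem : w ∉ H.gverts := fun h => hf.2 ⟨hf.1, Or.inl ⟨w, hw, h⟩⟩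
  refine ⟨u, w, hu, hw, ?_, ?_⟩
  · rw [SimpleGraph.edgeSet_deleteEdges]
    refine ⟨hadj, ?_⟩
    rintro ⟨-, ⟨v, hv, hvH⟩ | hd⟩
    · rcases Sym2.mem_iff.1 hv with rfl | rfl
      · exact hu_not_mem hvH
      · exact hw_not_mem hvH
    · obtain ⟨g, hg⟩ := H.dummies_crossed _ hd
      exact hun g hg
  · intro v hv
    rcases Sym2.mem_iff.1 hv with rfl | rfl
    · exact heR _ hu
    · exact hfR _ hw


end CopsRobbersOnePlanar
end

section
/- Let G be a finite connected graph with a fixed 1-planar drawing having no ×-crossings and with a kite edge at every crossing, let H be a guarded subgraph of G×, and let R := R(H) be the robber territory. Then for every vertex v of H, the graph I := R ∪ S_H(v), with its drawing inherited from G, is a 1-plane graph without ×-crossings; i.e., I ∈ Ĝ. -/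
namespace CopsRobbersOnePlanar

section

variable {G : SimpleGraph V} {D : OnePlanarDrawing G} {H : PlanSubgraph G D} {r v : V}

/-- Endpoints of edges of the robber territory lie in the robber territory and avoid `H`. -/
theorem mem_robberTerritory_of_mem_edge {e : Sym2 V} (he : e ∈ robberTerritoryEdges H r)
    {u : V} (hu : u ∈ e) : u ∈ robberTerritory H r ∧ u ∉ H.gverts := by
  refine ⟨he.2 u hu, fun hH => ?_⟩
  have h := he.1
  rw [SimpleGraph.edgeSet_deleteEdges] at h
  exact h.2 ⟨h.1, Or.inl ⟨u, hu, hH⟩⟩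

/-- Endpoints of edges of `S_H(v)` other than `v` lie in the robber territory and avoid `H`. -/
theorem mem_robberTerritory_or_eq_of_mem_SH {e : Sym2 V} (he : e ∈ SH H r v)
    {u : V} (hu : u ∈ e) : (u ∈ robberTerritory H r ∧ u ∉ H.gverts) ∨ u = v := by
  obtain ⟨w, rfl, -, hw, hwH, -⟩ := he
  rcases Sym2.mem_iff.mp hu with rfl | rfl
  · exact Or.inr rfl
  · exact Or.inl ⟨hw, hwH⟩

/-- An uncrossed edge is not a crossed edge through a dummy vertex of `H`. -/
theorem OnePlanarDrawing.Uncrossed.notMem_dummies {e : Sym2 V} (he : D.Uncrossed e) :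
    e ∉ H.dummies := fun h =>
  let ⟨f, hf⟩ := H.dummies_crossed e h
  he f hf

/-- An uncrossed edge between vertices of the robber territory outside `H` is an edge of it. -/
theorem OnePlanarDrawing.Uncrossed.mem_robberTerritoryEdges {u w : V}
    (huw : D.Uncrossed s(u, w)) (hadj : G.Adj u w)
    (hu : u ∈ robberTerritory H r ∧ u ∉ H.gverts)
    (hw : w ∈ robberTerritory H r ∧ w ∉ H.gverts) :
    s(u, w) ∈ robberTerritoryEdges H r := by
  constructor
  · rw [SimpleGraph.edgeSet_deleteEdges]
    refine ⟨hadj, ?_⟩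
    rintro ⟨-, ⟨x, hx, hxH⟩ | hd⟩
    · rcases Sym2.mem_iff.mp hx with rfl | rfl
      exacts [hu.2 hxH, hw.2 hxH]
    · exact huw.notMem_dummies hd
  · intro x hx
    rcases Sym2.mem_iff.mp hx with rfl | rfl
    exacts [hu.1, hw.1]

end

/-- Observation 3. Let `G` be a finite connected graph with a
fixed 1-planar drawing having no ×-crossings and a kite edge at every crossing,
let `H` be a subgraph of `G×` guarded (from time `N` on) in a play `π`, and let
`R := R(H)` be the robber territory (at the robber's current vertex `π.rob n`,
`n ≥ N`).  Then for every vertex `v` of `H` the graph `I := R ∪ S_H(v)`, with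
its drawing inherited from `G`, is a 1-plane graph without ×-crossings: every
crossing between two edges of `I` has an edge of `I` joining two consecutive
endpoints.  (For a `G`-vertex `v` of `H` the edges of `I` are those of `R`
together with `S_H(v)`; for a dummy vertex of `H` the edges of `S_H(v)` are
uncrossed half-edges of `G×`, so the crossings of `I` are those of `R`.) -/
theorem robberTerritory_union_SH_no_xcrossings
    {V : Type} [Fintype V] (G : SimpleGraph V) (hconn : G.Connected)
    (D : OnePlanarDrawing G)
    (hnoX : ∀ e f : Sym2 V, ¬ D.IsXCrossing e f) (hkite : D.HasKites)
    {k : ℕ} (π : GamePlay G k) (N : ℕ) (H : PlanSubgraph G D)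
    (hguard : GuardedSubgraph π N H) (n : ℕ) (hn : N ≤ n) :
    (∀ v ∈ H.gverts, ∀ e f : Sym2 V, D.Crosses e f →
      e ∈ robberTerritoryEdges H (π.rob n) ∪ SH H (π.rob n) v →
      f ∈ robberTerritoryEdges H (π.rob n) ∪ SH H (π.rob n) v →
      ∃ u w : V, u ∈ e ∧ w ∈ f ∧
        s(u, w) ∈ robberTerritoryEdges H (π.rob n) ∪ SH H (π.rob n) v) ∧
    (∀ e₀ ∈ H.dummies, ∀ e f : Sym2 V, D.Crosses e f →
      e ∈ robberTerritoryEdges H (π.rob n) →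
      f ∈ robberTerritoryEdges H (π.rob n) →
      ∃ u w : V, u ∈ e ∧ w ∈ f ∧
        s(u, w) ∈ robberTerritoryEdges H (π.rob n)) := by
  constructor
  · intro v _ e f hef he hf
    have endpoints : ∀ {g : Sym2 V} {x : V},
        g ∈ robberTerritoryEdges H (π.rob n) ∪ SH H (π.rob n) v → x ∈ g →
        (x ∈ robberTerritory H (π.rob n) ∧ x ∉ H.gverts) ∨ x = v := fun hg hx =>
      hg.elim (fun h => Or.inl (mem_robberTerritory_of_mem_edge h hx))
        (fun h => mem_robberTerritory_or_eq_of_mem_SH h hx)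
    obtain ⟨u, w, hu, hw, hadj, hunc⟩ := hkite e f hef
    refine ⟨u, w, hu, hw, ?_⟩
    rcases endpoints he hu with hu' | rfl <;> rcases endpoints hf hw with hw' | rfl
    · exact Or.inl (hunc.mem_robberTerritoryEdges hadj hu' hw')
    · exact Or.inr ⟨u, Sym2.eq_swap, hadj.symm, hu'.1, hu'.2, hunc.notMem_dummies⟩
    · exact Or.inr ⟨w, rfl, hadj, hw'.1, hw'.2, hunc.notMem_dummies⟩
    · exact absurd hadj (G.irrefl)
  · intro _ _ e f hef he hf
    obtain ⟨u, w, hu, hw, hadj, hunc⟩ := hkite e f hef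
    exact ⟨u, w, hu, hw, hunc.mem_robberTerritoryEdges hadj
      (mem_robberTerritory_of_mem_edge he hu) (mem_robberTerritory_of_mem_edge hf hw)⟩

end CopsRobbersOnePlanar
end
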